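/- arXiv:1602.05247 — 2 statements merged into one kernel-verified Lean document; each statement's English description precedes it below -/
import Mathlib

section
/- If t and u are column vectors with π^T t ≠ 0 and u^T e ≠ 0, and G = (I − P + t u^T)^{-1}, then G t = (1/(u^T e)) e and u^T G = (1/(π^T t)) π^T. -/
open Matrix

/-- A rank-one update `A + t uᵀ` of a matrix with right kernel contained in the span of `x` and `yᵀ A = 0`
is invertible as soon as `yᵀ t ≠ 0` and `uᵀ x ≠ 0`. -/
theorem isUnit_det_add_vecMulVec {n K : Type*} [Fintype n] [DecidableEq n] [Field K]
    {A : Matrix n n K} {x y t u : n → K}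
    (hker : ∀ z : n → K, A *ᵥ z = 0 → ∃ c : K, z = c • x) (hy : y ᵥ* A = 0)
    (ht : y ⬝ᵥ t ≠ 0) (hu : u ⬝ᵥ x ≠ 0) :
    IsUnit (A + vecMulVec t u).det := by
  rw [isUnit_iff_ne_zero]
  intro hdet
  obtain ⟨v, hv0, hv⟩ := exists_mulVec_eq_zero_iff.mpr hdet
  rw [add_mulVec, vecMulVec_mulVec, op_smul_eq_smul] at hv
  have huv : u ⬝ᵥ v = 0 := by
    have h := congrArg (y ⬝ᵥ ·) hv
    simpa [dotProduct_add, dotProduct_mulVec, hy, ht] using h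
  rw [huv, zero_smul, add_zero] at hv
  obtain ⟨c, rfl⟩ := hker v hv
  have hc : c = 0 := by simpa [hu] using huv
  exact hv0 (by simp [hc])

/-- If `A x = 0`, then `(A + t uᵀ)⁻¹ t = (uᵀ x)⁻¹ x`. -/
theorem inv_add_vecMulVec_mulVec {n K : Type*} [Fintype n] [DecidableEq n] [Field K]
    {A : Matrix n n K} {x t u : n → K} (hx : A *ᵥ x = 0) (hu : u ⬝ᵥ x ≠ 0)
    (hdet : IsUnit (A + vecMulVec t u).det) :
    (A + vecMulVec t u)⁻¹ *ᵥ t = (1 / (u ⬝ᵥ x)) • x := by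
  have h : (A + vecMulVec t u) *ᵥ ((1 / (u ⬝ᵥ x)) • x) = t := by
    simp [mulVec_smul, add_mulVec, hx, vecMulVec_mulVec, smul_smul, hu]
  have hinv := congrArg ((A + vecMulVec t u)⁻¹ *ᵥ ·) h
  simpa only [mulVec_mulVec, nonsing_inv_mul _ hdet, one_mulVec] using hinv.symm

/-- If `yᵀ A = 0`, then `uᵀ (A + t uᵀ)⁻¹ = (yᵀ t)⁻¹ yᵀ`. -/
theorem vecMul_inv_add_vecMulVec {n K : Type*} [Fintype n] [DecidableEq n] [Field K]
    {A : Matrix n n K} {y t u : n → K} (hy : y ᵥ* A = 0) (ht : y ⬝ᵥ t ≠ 0)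
    (hdet : IsUnit (A + vecMulVec t u).det) :
    u ᵥ* (A + vecMulVec t u)⁻¹ = (1 / (y ⬝ᵥ t)) • y := by
  have h : ((1 / (y ⬝ᵥ t)) • y) ᵥ* (A + vecMulVec t u) = u := by
    simp [smul_vecMul, vecMul_add, hy, vecMul_vecMulVec, ht]
  have hinv := congrArg (· ᵥ* (A + vecMulVec t u)⁻¹) h
  simpa only [vecMul_vecMul, mul_nonsing_inv _ hdet, vecMul_one] using hinv.symm

theorem stmt_2 {m : ℕ} (hm : 1 ≤ m)
    (P : Matrix (Fin m) (Fin m) ℝ) (π : Fin m → ℝ)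
    (hP0 : ∀ i j, 0 ≤ P i j)
    (hPe : P *ᵥ 1 = 1)
    (hker : ∀ x : Fin m → ℝ, (1 - P) *ᵥ x = 0 → ∃ c : ℝ, x = c • (1 : Fin m → ℝ))
    (hcoker : ∀ y : Fin m → ℝ, y ᵥ* (1 - P) = 0 → ∃ c : ℝ, y = c • π)
    (hπP : π ᵥ* P = π) (hπe : π ⬝ᵥ 1 = 1) (hπpos : ∀ i, 0 < π i)
    (t u : Fin m → ℝ) (ht : π ⬝ᵥ t ≠ 0) (hu : u ⬝ᵥ 1 ≠ 0)
    (G : Matrix (Fin m) (Fin m) ℝ) (hG : G = (1 - P + vecMulVec t u)⁻¹) :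
    G *ᵥ t = (1 / (u ⬝ᵥ 1)) • (1 : Fin m → ℝ) ∧
    u ᵥ* G = (1 / (π ⬝ᵥ t)) • π := by
  have h1 : (1 - P) *ᵥ (1 : Fin m → ℝ) = 0 := by rw [sub_mulVec, one_mulVec, hPe, sub_self]
  have hπ : π ᵥ* (1 - P) = 0 := by rw [vecMul_sub, vecMul_one, hπP, sub_self]
  have hdet := isUnit_det_add_vecMulVec hker hπ ht hu
  subst hG
  exact ⟨inv_add_vecMulVec_mulVec h1 hu hdet, vecMul_inv_add_vecMulVec hπ ht hdet⟩
end

section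
/- Let G be a one-condition g-inverse of A = I − P, and define α = (I − A G) e and β^T = π^T (I − G A). Then A G = G A if and only if α = e and β^T = π^T. -/
open Matrix

/-- If every vector in the left kernel of `A` is a multiple of `v`, with `v ⬝ᵥ w = 1`, then a matrix
`M` with `M * A = 0` is determined by `M *ᵥ w`. -/
theorem eq_vecMulVec_of_mul_eq_zero {n R : Type*} [Fintype n] [CommRing R]
    {A M : Matrix n n R} {v w : n → R}
    (hA : ∀ y : n → R, y ᵥ* A = 0 → ∃ c : R, y = c • v)
    (hvw : v ⬝ᵥ w = 1) (hM : M * A = 0) : M = vecMulVec (M *ᵥ w) v := by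
  ext i j
  obtain ⟨c, hc⟩ := hA (M i) (congrFun hM i)
  have hMw : (M *ᵥ w) i = c := by
    change M i ⬝ᵥ w = c
    rw [hc, smul_dotProduct, hvw, smul_eq_mul, mul_one]
  rw [vecMulVec_apply, hMw, hc, Pi.smul_apply, smul_eq_mul]

/-- The transposed version of `eq_vecMulVec_of_mul_eq_zero`: if every vector in the kernel of `A` is a
multiple of `w`, with `v ⬝ᵥ w = 1`, then a matrix `M` with `A * M = 0` is determined by `v ᵥ* M`. -/
theorem eq_vecMulVec_of_mul_eq_zero' {n R : Type*} [Fintype n] [CommRing R]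
    {A M : Matrix n n R} {v w : n → R}
    (hA : ∀ x : n → R, A *ᵥ x = 0 → ∃ c : R, x = c • w)
    (hvw : v ⬝ᵥ w = 1) (hM : A * M = 0) : M = vecMulVec w (v ᵥ* M) := by
  have h := eq_vecMulVec_of_mul_eq_zero (A := Aᵀ) (M := Mᵀ) (v := w) (w := v)
    (by simpa only [vecMul_transpose] using hA) (by rwa [dotProduct_comm])
    (by rw [← transpose_mul, hM, transpose_zero])
  rw [← transpose_inj, h, transpose_vecMulVec, mulVec_transpose]

theorem stmt_6 {m : ℕ} (hm : 1 ≤ m)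
    (P : Matrix (Fin m) (Fin m) ℝ) (π : Fin m → ℝ)
    (hP0 : ∀ i j, 0 ≤ P i j)
    (hPe : P *ᵥ 1 = 1)
    (hker : ∀ x : Fin m → ℝ, (1 - P) *ᵥ x = 0 → ∃ c : ℝ, x = c • (1 : Fin m → ℝ))
    (hcoker : ∀ y : Fin m → ℝ, y ᵥ* (1 - P) = 0 → ∃ c : ℝ, y = c • π)
    (hπP : π ᵥ* P = π) (hπe : π ⬝ᵥ 1 = 1) (hπpos : ∀ i, 0 < π i)
    (G : Matrix (Fin m) (Fin m) ℝ) (hG : (1 - P) * G * (1 - P) = 1 - P)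
    (α β : Fin m → ℝ)
    (hα : α = (1 - (1 - P) * G) *ᵥ 1)
    (hβ : β = π ᵥ* (1 - G * (1 - P))) :
    (1 - P) * G = G * (1 - P) ↔ α = 1 ∧ β = π := by
  have hAe : (1 - P) *ᵥ 1 = 0 := by rw [sub_mulVec, one_mulVec, hPe, sub_self]
  have hπA : π ᵥ* (1 - P) = 0 := by rw [vecMul_sub, vecMul_one, hπP, sub_self]
  constructor
  · intro h
    constructor
    · rw [hα, h, sub_mulVec, one_mulVec, ← mulVec_mulVec, hAe, mulVec_zero, sub_zero]
    · rw [hβ, ← h, vecMul_sub, vecMul_one, ← vecMul_vecMul, hπA, zero_vecMul, sub_zero]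
  · rintro ⟨h₁, h₂⟩
    have hAG := eq_vecMulVec_of_mul_eq_zero (M := 1 - (1 - P) * G) hcoker hπe
      (by rw [sub_mul, one_mul, hG, sub_self])
    have hGA := eq_vecMulVec_of_mul_eq_zero' (M := 1 - G * (1 - P)) hker hπe
      (by rw [mul_sub, mul_one, ← mul_assoc, hG, sub_self])
    rw [← hα, h₁] at hAG
    rw [← hβ, h₂] at hGA
    exact sub_right_injective (hAG.trans hGA.symm)
end
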